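/- P(1/6, 5/6) = 2^{−5/6} · 3^{−1/4} · B(1/4, 1/4)², and moreover P(1/6, 5/6) = 2^{1/6} · 3^{−1/4} · B(1/4, 1/2)². -/

import Mathlib

open Real

/-- Ascending Pochhammer symbol `(x)_k = x(x+1)⋯(x+k−1)`. -/
noncomputable def poch (x : ℝ) (k : ℕ) : ℝ := (ascPochhammer ℝ k).eval x

/-- The Beta function quotient `B(x,y) = Γ(x)Γ(y)/Γ(x+y)`. -/
noncomputable def betaR (x y : ℝ) : ℝ := Gamma x * Gamma y / Gamma (x + y)

/-- Generalized hypergeometric series `₃F₂(a₁,a₂,a₃; b₁,b₂; z)`. -/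
noncomputable def F32 (a1 a2 a3 b1 b2 z : ℝ) : ℝ :=
  ∑' k : ℕ, (poch a1 k * poch a2 k * poch a3 k)
      / (poch b1 k * poch b2 k * (k.factorial : ℝ)) * z ^ k

/-- The hypergeometric period value `P(r,s) = π · B(r, s−r) · ₃F₂(1/2,1/2,r; 1,s; 1)`. -/
noncomputable def P (r s : ℝ) : ℝ := π * betaR r (s - r) * F32 (1/2) (1/2) r 1 s 1

open MeasureTheory Set

lemma poch_zero (x : ℝ) : poch x 0 = 1 := by simp [poch]

lemma poch_succ (x : ℝ) (k : ℕ) : poch x (k + 1) = poch x k * (x + k) := by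
  simp [poch, ascPochhammer_succ_eval]

lemma poch_pos {x : ℝ} (hx : 0 < x) (k : ℕ) : 0 < poch x k := ascPochhammer_pos k x hx

lemma poch_one (k : ℕ) : poch 1 k = k.factorial := by simp [poch]

lemma Gamma_add_nat {x : ℝ} (hx : 0 < x) (k : ℕ) : Gamma (x + k) = poch x k * Gamma x := by
  induction k with
  | zero => simp [poch_zero]
  | succ k ih =>
    rw [Nat.cast_succ, ← add_assoc, Gamma_add_one (by positivity), ih, poch_succ]
    ring

lemma poch_two_mul (x : ℝ) (m : ℕ) :
    poch x (2 * m) = 4 ^ m * poch (x / 2) m * poch (x / 2 + 1 / 2) m := by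
  induction m with
  | zero => simp [poch_zero]
  | succ m ih =>
    rw [show 2 * (m + 1) = 2 * m + 1 + 1 by ring, poch_succ, poch_succ, ih, poch_succ, poch_succ]
    push_cast
    ring

lemma betaR_pos {p q : ℝ} (hp : 0 < p) (hq : 0 < q) : 0 < betaR p q :=
  ProbabilityTheory.beta_pos hp hq

lemma betaR_add_nat {p q : ℝ} (hp : 0 < p) (hq : 0 < q) (k : ℕ) :
    betaR (p + k) q = poch p k / poch (p + q) k * betaR p q := by
  have h := (poch_pos (add_pos hp hq) k).ne'
  have h' := (Gamma_pos_of_pos (add_pos hp hq)).ne'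
  rw [betaR, betaR, add_right_comm, Gamma_add_nat hp, Gamma_add_nat (add_pos hp hq)]
  field_simp

/-- The binomial series. -/
lemma hasSum_poch_div_factorial_mul_pow (a : ℝ) {x : ℝ} (hx : |x| < 1) :
    HasSum (fun n : ℕ ↦ poch a n / n.factorial * x ^ n) ((1 - x) ^ (-a)) := by
  have h := (one_div_one_sub_rpow_hasFPowerSeriesOnBall_zero a).hasSum
    (y := x) (by simpa [enorm_eq_nnnorm, ← NNReal.coe_lt_coe] using hx)
  have h1 : 0 < 1 - x := by linarith [(abs_lt.mp hx).2]
  simp only [zero_add, one_div, ← rpow_neg h1.le] at h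
  convert! h using 2 with n
  have h2 := Ring.factorial_nsmul_multichoose_eq_ascPochhammer a n
  have h3 : (n.factorial : ℝ) ≠ 0 := by positivity
  rw [nsmul_eq_mul, ← Polynomial.eval₂_smulOneHom_eq_smeval] at h2
  simp only [FormalMultilinearSeries.ofScalars_apply_eq, Ring.choose, smul_eq_mul]
  rw [show a + n - 1 - n + 1 = a by ring, poch]
  congr 1
  rw [div_eq_iff h3, mul_comm, h2]
  simp [Polynomial.eval₂_eq_eval_map]

/-- Euler's beta integral. -/
lemma lintegral_beta {p q : ℝ} (hp : 0 < p) (hq : 0 < q) :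
    ∫⁻ u in Ioo (0 : ℝ) 1, ENNReal.ofReal (u ^ (p - 1) * (1 - u) ^ (q - 1)) =
      ENNReal.ofReal (betaR p q) := by
  have hb : 0 < betaR p q := betaR_pos hp hq
  have h := ProbabilityTheory.lintegral_betaPDF_eq_one hp hq
  rw [ProbabilityTheory.lintegral_betaPDF] at h
  have h1 : ∀ u : ℝ, ENNReal.ofReal (1 / ProbabilityTheory.beta p q * u ^ (p - 1) *
      (1 - u) ^ (q - 1)) = ENNReal.ofReal (1 / betaR p q) *
        ENNReal.ofReal (u ^ (p - 1) * (1 - u) ^ (q - 1)) := fun u ↦ by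
    rw [← ENNReal.ofReal_mul (by positivity), mul_assoc]
    rfl
  simp_rw [h1] at h
  rw [lintegral_const_mul' _ _ ENNReal.ofReal_ne_top] at h
  have h2 : ENNReal.ofReal (betaR p q) * ENNReal.ofReal (1 / betaR p q) = 1 := by
    rw [← ENNReal.ofReal_mul hb.le, mul_one_div_cancel hb.ne', ENNReal.ofReal_one]
  rw [← one_mul (∫⁻ _ in _, _), ← h2, mul_assoc, h, mul_one]

lemma lintegral_beta_mul_tsum {p q : ℝ} (hp : 0 < p) (hq : 0 < q) {c : ℕ → ℝ}
    (hc : ∀ m, 0 ≤ c m) :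
    ∫⁻ u in Ioo (0 : ℝ) 1, ENNReal.ofReal (u ^ (p - 1) * (1 - u) ^ (q - 1)) *
        ∑' m, ENNReal.ofReal (c m * u ^ m) =
      ∑' m, ENNReal.ofReal (c m * betaR (p + m) q) := by
  simp_rw [← ENNReal.tsum_mul_left]
  rw [lintegral_tsum (fun m ↦ by fun_prop)]
  congr 1
  ext m
  rw [ENNReal.ofReal_mul (hc m), ← lintegral_beta (by positivity) hq,
    ← lintegral_const_mul' _ _ ENNReal.ofReal_ne_top]
  refine setLIntegral_congr_fun measurableSet_Ioo fun u hu ↦ ?_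
  have hu0 : 0 < u := hu.1
  have hu1 : 0 < 1 - u := sub_pos.2 hu.2
  rw [← ENNReal.ofReal_mul (by positivity), ← ENNReal.ofReal_mul (hc m),
    show p + m - 1 = (p - 1) + m by ring, rpow_add hu0, rpow_natCast]
  ring_nf

/-- Gauss's evaluation of `₂F₁` at `1`, with the lower parameter absorbed in a beta function. -/
lemma tsum_poch_mul_betaR {a b q : ℝ} (ha : 0 < a) (hb : 0 < b) (hq : a < q) :
    ∑' m : ℕ, ENNReal.ofReal (poch a m / m.factorial * betaR (b + m) q) =
      ENNReal.ofReal (betaR b (q - a)) := by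
  have hc (m : ℕ) : 0 ≤ poch a m / m.factorial := by
    have := poch_pos ha m
    positivity
  rw [← lintegral_beta_mul_tsum hb (ha.trans hq) hc, ← lintegral_beta hb (sub_pos.2 hq)]
  refine setLIntegral_congr_fun measurableSet_Ioo fun u hu ↦ ?_
  have hu0 : 0 < u := hu.1
  have hu1 : 0 < 1 - u := sub_pos.2 hu.2
  have hs := hasSum_poch_div_factorial_mul_pow a (abs_lt.2 ⟨by linarith, hu.2⟩)
  rw [← ENNReal.ofReal_tsum_of_nonneg (fun m ↦ mul_nonneg (hc m) (by positivity)) hs.summable,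
    hs.tsum_eq, ← ENNReal.ofReal_mul (by positivity), mul_assoc, ← rpow_add hu1]
  ring_nf

/-- The substitution `u = (t / (2 - t)) ^ 2` in a beta integral. -/
lemma lintegral_comp_div_two_sub_sq (a b : ℝ) (g : ℝ → ENNReal) :
    ∫⁻ t in Ioo (0 : ℝ) 1, ENNReal.ofReal
        (t ^ (b - 1) * (1 - t) ^ ((a - b - 1) / 2) * (1 - t / 2) ^ (-a)) *
          g ((t / (2 - t)) ^ 2) =
      ENNReal.ofReal (2 ^ (b - 1)) * ∫⁻ u in Ioo (0 : ℝ) 1,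
        ENNReal.ofReal (u ^ (b / 2 - 1) * (1 - u) ^ ((a - b - 1) / 2)) * g u := by
  have himg : (fun t : ℝ ↦ (t / (2 - t)) ^ 2) '' Ioo 0 1 = Ioo 0 1 := by
    ext u
    constructor
    · rintro ⟨t, ⟨h0, h1⟩, rfl⟩
      have : 0 < t / (2 - t) := div_pos h0 (by linarith)
      have : t / (2 - t) < 1 := (div_lt_one (by linarith)).2 (by linarith)
      exact ⟨by positivity, by nlinarith⟩
    · rintro ⟨h0, h1⟩
      have hs : 0 < √u := sqrt_pos.2 h0
      have hs1 : √u < 1 := by rw [sqrt_lt' one_pos]; simpa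
      refine ⟨2 * √u / (1 + √u), ⟨by positivity, (div_lt_one (by positivity)).2 (by linarith)⟩, ?_⟩
      have : 2 * √u / (1 + √u) / (2 - 2 * √u / (1 + √u)) = √u := by
        rw [show 2 - 2 * √u / (1 + √u) = 2 / (1 + √u) by field_simp; ring]
        field_simp
      simp only [this, sq_sqrt h0.le]
  have hinj : InjOn (fun t : ℝ ↦ (t / (2 - t)) ^ 2) (Ioo 0 1) := by
    intro s hs t ht h
    have hs2 : 0 < 2 - s := by linarith [hs.2]
    have ht2 : 0 < 2 - t := by linarith [ht.2]
    have h' := (sq_eq_sq₀ (div_nonneg hs.1.le hs2.le) (div_nonneg ht.1.le ht2.le)).1 h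
    rw [div_eq_div_iff hs2.ne' ht2.ne'] at h'
    linarith
  have hderiv : ∀ t ∈ Ioo (0 : ℝ) 1, HasDerivWithinAt (fun t : ℝ ↦ (t / (2 - t)) ^ 2)
      (4 * t / (2 - t) ^ 3) (Ioo 0 1) t := by
    intro t ht
    have ht2 : 2 - t ≠ 0 := by linarith [ht.2]
    have := (((hasDerivAt_id' t).div ((hasDerivAt_id' t).const_sub 2) ht2).pow 2).hasDerivWithinAt
      (s := Ioo 0 1)
    convert! this using 1
    simp
    field_simp
    ring
  conv_rhs => rw [← himg]
  rw [lintegral_image_eq_lintegral_abs_deriv_mul measurableSet_Ioo hderiv hinj,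
    ← lintegral_const_mul' _ _ ENNReal.ofReal_ne_top]
  refine setLIntegral_congr_fun measurableSet_Ioo fun t ht ↦ ?_
  have ht0 : 0 < t := ht.1
  have ht1 : 0 < 1 - t := sub_pos.2 ht.2
  have ht2 : 0 < 2 - t := by linarith
  rw [← mul_assoc, ← mul_assoc, ← ENNReal.ofReal_mul (by positivity),
    ← ENNReal.ofReal_mul (by positivity)]
  congr 2
  rw [abs_of_pos (by positivity), show 1 - (t / (2 - t)) ^ 2 = 2 ^ 2 * (1 - t) / (2 - t) ^ 2 by
    field_simp; ring, show 1 - t / 2 = (2 - t) / 2 by ring]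
  refine log_injOn_pos (mem_Ioi.2 (by positivity)) (mem_Ioi.2 (by positivity)) ?_
  have e4 : log 4 = 2 * log 2 := by rw [← log_rpow two_pos]; norm_num
  have l1 : log (4 * t / (2 - t) ^ 3) = 2 * log 2 + log t - 3 * log (2 - t) := by
    rw [log_div (by positivity) (by positivity), log_mul (by positivity) (by positivity), log_pow,
      e4]
    norm_num
  have l2 : log ((t / (2 - t)) ^ 2) = 2 * (log t - log (2 - t)) := by
    rw [log_pow, log_div (by positivity) (by positivity)]
    norm_num
  have l3 : log (2 ^ 2 * (1 - t) / (2 - t) ^ 2) = 2 * log 2 + log (1 - t) - 2 * log (2 - t) := by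
    rw [log_div (by positivity) (by positivity), log_mul (by positivity) (by positivity), log_pow,
      log_pow]
    norm_num
  rw [log_mul (by positivity) (by positivity), log_mul (by positivity) (by positivity),
    log_mul (by positivity) (by positivity), log_mul (by positivity) (by positivity),
    log_mul (by positivity) (by positivity), log_rpow (by positivity), log_rpow (by positivity),
    log_rpow (by positivity), log_rpow (by positivity), log_rpow (by positivity),
    log_rpow (by positivity), l1, l2, l3, log_div (by positivity) (by positivity)]
  ring

lemma integral_cos_two_mul_pow (n : ℕ) :
    ∫ θ in 0..π, cos (2 * θ) ^ n = (∫ θ in 0..2 * π, cos θ ^ n) / 2 := by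
  rw [intervalIntegral.integral_comp_mul_left (fun θ ↦ cos θ ^ n) two_ne_zero]
  simp [div_eq_inv_mul]

lemma integral_cos_two_mul_pow_even (m : ℕ) :
    ∫ θ in 0..π, cos (2 * θ) ^ (2 * m) = π * (poch (1 / 2) m / m.factorial) := by
  rw [integral_cos_two_mul_pow]
  induction m with
  | zero => simp [poch_zero]
  | succ m ih =>
    rw [div_eq_iff two_ne_zero] at ih ⊢
    rw [mul_add, mul_one, integral_cos_pow, ih, poch_succ, Nat.factorial_succ]
    simp only [sin_two_pi, sin_zero, mul_zero, sub_self, zero_div, zero_add]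
    push_cast
    field_simp
    ring

lemma integral_cos_two_mul_pow_odd (m : ℕ) :
    ∫ θ in 0..π, cos (2 * θ) ^ (2 * m + 1) = 0 := by
  rw [integral_cos_two_mul_pow]
  induction m with
  | zero => simp
  | succ m ih =>
    rw [show 2 * (m + 1) + 1 = 2 * m + 1 + 2 by ring, integral_cos_pow]
    simp only [div_eq_zero_iff, OfNat.ofNat_ne_zero, or_false] at ih
    simp [ih]

lemma integral_sin_sq_pow (m : ℕ) :
    ∫ θ in 0..π, (sin θ ^ 2) ^ m = π * (poch (1 / 2) m / m.factorial) := by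
  simp_rw [← pow_mul]
  rw [integral_sin_pow_even]
  congr 1
  induction m with
  | zero => simp [poch_zero]
  | succ m ih =>
    rw [Finset.prod_range_succ, ih, poch_succ, Nat.factorial_succ]
    push_cast
    field_simp
    ring

lemma hasSum_integral_one_sub_mul_rpow {a z : ℝ} (ha : 0 < a) (hz : |z| < 1) {g : ℝ → ℝ}
    (hg : Continuous g) (hg1 : ∀ θ, |g θ| ≤ 1) :
    HasSum (fun n : ℕ ↦ poch a n / n.factorial * z ^ n * ∫ θ in 0..π, g θ ^ n)
      (∫ θ in 0..π, (1 - z * g θ) ^ (-a)) := by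
  have hc (m : ℕ) : 0 ≤ poch a m / m.factorial := by
    have := poch_pos ha m
    positivity
  have hs := (hasSum_poch_div_factorial_mul_pow a (x := |z|) (by simpa using hz)).summable
  simp_rw [← intervalIntegral.integral_const_mul]
  refine intervalIntegral.hasSum_integral_of_dominated_convergence
    (fun n _ ↦ poch a n / n.factorial * |z| ^ n) (fun n ↦ ?_) (fun n ↦ ?_) ?_ ?_ ?_
  · exact (by fun_prop : Continuous _).aestronglyMeasurable
  · refine Filter.Eventually.of_forall fun θ _ ↦ ?_
    rw [norm_mul, norm_mul, norm_pow, norm_pow, norm_eq_abs, norm_eq_abs, norm_eq_abs,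
      abs_of_nonneg (hc n)]
    exact mul_le_of_le_one_right (mul_nonneg (hc n) (by positivity))
      (pow_le_one₀ (abs_nonneg _) (hg1 θ))
  · exact Filter.Eventually.of_forall fun θ _ ↦ hs
  · exact intervalIntegrable_const
  · refine Filter.Eventually.of_forall fun θ _ ↦ ?_
    have : |z * g θ| < 1 := by
      rw [abs_mul]
      exact (mul_le_of_le_one_right (abs_nonneg _) (hg1 θ)).trans_lt hz
    simpa only [mul_pow, mul_assoc] using hasSum_poch_div_factorial_mul_pow a this

/-- A quadratic transformation of `₂F₁(1/2, 1/2; 1; t)`. -/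
lemma tsum_quadratic_transformation {t : ℝ} (ht0 : 0 < t) (ht1 : t < 1) :
    ∑' k : ℕ, ENNReal.ofReal ((poch (1 / 2) k / k.factorial) ^ 2 * t ^ k) =
      ENNReal.ofReal ((1 - t / 2) ^ (-(1 / 2) : ℝ)) *
        ∑' m : ℕ, ENNReal.ofReal (poch (1 / 4) m * poch (3 / 4) m / (m.factorial : ℝ) ^ 2 *
          ((t / (2 - t)) ^ 2) ^ m) := by
  have ht2 : 0 < 2 - t := by linarith
  have hz0 : 0 < t / (2 - t) := by positivity
  have hz1 : t / (2 - t) < 1 := (div_lt_one ht2).2 (by linarith)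
  have h1 := hasSum_integral_one_sub_mul_rpow (a := 1 / 2) (z := t) (by norm_num)
    (abs_lt.2 ⟨by linarith, ht1⟩) (g := fun θ ↦ sin θ ^ 2) (by fun_prop)
    (fun θ ↦ by rw [abs_of_nonneg (sq_nonneg _)]; exact sin_sq_le_one θ)
  have h2 := hasSum_integral_one_sub_mul_rpow (a := 1 / 2) (z := -(t / (2 - t))) (by norm_num)
    (abs_lt.2 ⟨by linarith, by linarith⟩) (g := fun θ ↦ cos (2 * θ)) (by fun_prop)
    (fun θ ↦ abs_cos_le_one _)
  have hI : ∫ θ in 0..π, (1 - t * sin θ ^ 2) ^ (-(1 / 2) : ℝ) = (1 - t / 2) ^ (-(1 / 2) : ℝ) *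
      ∫ θ in 0..π, (1 - -(t / (2 - t)) * cos (2 * θ)) ^ (-(1 / 2) : ℝ) := by
    rw [← intervalIntegral.integral_const_mul]
    congr 1
    ext θ
    have := neg_one_le_cos (2 * θ)
    rw [← mul_rpow (by linarith) (by nlinarith), sin_sq_eq_half_sub]
    congr 1
    field_simp
    ring
  rw [hI] at h1
  rw [← Function.Injective.hasSum_iff (mul_right_injective₀ (two_ne_zero' ℕ))] at h2
  · simp_rw [integral_sin_sq_pow] at h1
    simp only [Function.comp_def, integral_cos_two_mul_pow_even] at h2
    replace h1 := h1.div_const π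
    replace h2 := h2.div_const π
    have e1 : (fun k : ℕ ↦ poch (1 / 2) k / k.factorial * t ^ k *
        (π * (poch (1 / 2) k / k.factorial)) / π) =
        fun k : ℕ ↦ (poch (1 / 2) k / k.factorial) ^ 2 * t ^ k := by
      ext k
      field_simp
    have e2 : (fun m : ℕ ↦ poch (1 / 2) (2 * m) / (2 * m).factorial * (-(t / (2 - t))) ^ (2 * m) *
        (π * (poch (1 / 2) m / m.factorial)) / π) =
        fun m : ℕ ↦ poch (1 / 4) m * poch (3 / 4) m / (m.factorial : ℝ) ^ 2 *
          ((t / (2 - t)) ^ 2) ^ m := by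
      ext m
      have := poch_pos (x := 1 / 2) (by norm_num) m
      rw [← poch_one (2 * m), poch_two_mul, poch_two_mul, pow_mul, neg_sq, ← poch_one]
      have := poch_pos one_pos m
      norm_num
      field_simp
    rw [e1] at h1
    rw [e2] at h2
    rw [← ENNReal.ofReal_tsum_of_nonneg (fun k ↦ by positivity) h1.summable,
      ← ENNReal.ofReal_tsum_of_nonneg (fun m ↦ ?_) h2.summable, h1.tsum_eq, h2.tsum_eq,
      ← ENNReal.ofReal_mul (rpow_nonneg (by linarith) _), mul_div_assoc]
    have := poch_pos (x := 1 / 4) (by norm_num) m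
    have := poch_pos (x := 3 / 4) (by norm_num) m
    positivity
  · intro n hn
    obtain ⟨m, rfl⟩ : Odd n := by
      rw [← Nat.not_even_iff_odd]
      rintro ⟨m, rfl⟩
      exact hn ⟨m, by simp [two_mul]⟩
    rw [integral_cos_two_mul_pow_odd, mul_zero]

lemma tsum_poch_sq_mul_betaR :
    ∑' k : ℕ, ENNReal.ofReal ((poch (1 / 2) k / k.factorial) ^ 2 * betaR (1 / 6 + k) (2 / 3)) =
      ENNReal.ofReal (2 ^ (-5 / 6 : ℝ) * (Gamma (2 / 3) / (Gamma (3 / 4) * Gamma (11 / 12)) *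
        betaR (1 / 12) (2 / 3))) := by
  have hG1 := Gamma_pos_of_pos (s := 2 / 3) (by norm_num)
  have hG2 := Gamma_pos_of_pos (s := 3 / 4) (by norm_num)
  have hG3 := Gamma_pos_of_pos (s := 11 / 12) (by norm_num)
  have hc (m : ℕ) : 0 ≤ poch (1 / 4) m * poch (3 / 4) m / (m.factorial : ℝ) ^ 2 := by
    have := poch_pos (x := 1 / 4) (by norm_num) m
    have := poch_pos (x := 3 / 4) (by norm_num) m
    positivity
  rw [← lintegral_beta_mul_tsum (by norm_num) (by norm_num) (fun k ↦ sq_nonneg _)]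
  have hq : ∀ t ∈ Ioo (0 : ℝ) 1, ENNReal.ofReal (t ^ (1 / 6 - 1 : ℝ) * (1 - t) ^ (2 / 3 - 1 : ℝ)) *
      ∑' k : ℕ, ENNReal.ofReal ((poch (1 / 2) k / k.factorial) ^ 2 * t ^ k) =
      ENNReal.ofReal (t ^ (1 / 6 - 1 : ℝ) * (1 - t) ^ ((1 / 2 - 1 / 6 - 1) / 2 : ℝ) *
        (1 - t / 2) ^ (-(1 / 2) : ℝ)) * ∑' m : ℕ, ENNReal.ofReal (poch (1 / 4) m * poch (3 / 4) m /
          (m.factorial : ℝ) ^ 2 * ((t / (2 - t)) ^ 2) ^ m) := by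
    intro t ht
    have ht0 : 0 < t := ht.1
    have ht1 : 0 < 1 - t := sub_pos.2 ht.2
    rw [tsum_quadratic_transformation ht.1 ht.2, ← mul_assoc, ← ENNReal.ofReal_mul (by positivity)]
    norm_num
  rw [setLIntegral_congr_fun measurableSet_Ioo hq,
    lintegral_comp_div_two_sub_sq (1 / 2) (1 / 6) (fun u ↦ ∑' m : ℕ, ENNReal.ofReal
      (poch (1 / 4) m * poch (3 / 4) m / (m.factorial : ℝ) ^ 2 * u ^ m)),
    show ((1 / 2 - 1 / 6 - 1) / 2 : ℝ) = 2 / 3 - 1 by norm_num,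
    lintegral_beta_mul_tsum (by norm_num) (by norm_num) hc, ENNReal.ofReal_mul (by positivity),
    ENNReal.ofReal_mul (by positivity), show (2 / 3 : ℝ) = 11 / 12 - 1 / 4 by norm_num,
    ← tsum_poch_mul_betaR (by norm_num) (by norm_num) (by norm_num)]
  norm_num only
  congr 1
  rw [← ENNReal.tsum_mul_left]
  refine tsum_congr fun m ↦ ?_
  rw [← ENNReal.ofReal_mul (by positivity), betaR, betaR]
  have h34 := Gamma_add_nat (x := 3 / 4) (by norm_num) m
  have h1 := Gamma_add_nat one_pos m
  rw [Gamma_one, mul_one, poch_one] at h1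
  rw [show (1 / 12 + m + 2 / 3 : ℝ) = 3 / 4 + m by ring,
    show (1 / 12 + m + 11 / 12 : ℝ) = 1 + m by ring, h34, h1]
  have := poch_pos (x := 3 / 4) (by norm_num) m
  congr 1
  field_simp

/-- Gauss's multiplication formula for the Gamma function in the case of three factors. -/
lemma Gamma_mul_Gamma_mul_Gamma_third {s : ℝ} (hs : 0 < s) :
    Gamma (s / 3) * Gamma (s / 3 + 1 / 3) * Gamma (s / 3 + 2 / 3) =
      3 ^ (1 - s) * (Gamma (1 / 3) * Gamma (2 / 3)) * Gamma s := by
  have hG1 := Gamma_pos_of_pos (s := 1 / 3) (by norm_num)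
  have hG2 := Gamma_pos_of_pos (s := 2 / 3) (by norm_num)
  have hpos {y c : ℝ} (hy : 0 < y) (hc : 0 ≤ c) : 0 < Gamma (y / 3 + c) :=
    Gamma_pos_of_pos (by positivity)
  let f : ℝ → ℝ := fun s ↦ Gamma (s / 3 + 0) * Gamma (s / 3 + 1 / 3) * Gamma (s / 3 + 2 / 3) *
    3 ^ (s - 1) / (Gamma (1 / 3) * Gamma (2 / 3))
  have hconv {c : ℝ} (hc : 0 ≤ c) : ConvexOn ℝ (Ioi 0) fun s ↦ log (Gamma (s / 3 + c)) := by
    refine ⟨convex_Ioi 0, fun x hx y hy a b ha hb hab ↦ ?_⟩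
    have hx' : (0 : ℝ) < x := hx
    have hy' : (0 : ℝ) < y := hy
    have h := convexOn_log_Gamma.2 (x := x / 3 + c) (mem_Ioi.2 (by positivity))
      (y := y / 3 + c) (mem_Ioi.2 (by positivity)) ha hb hab
    simp only [smul_eq_mul, Function.comp_apply] at h ⊢
    convert h using 3
    linear_combination (-c) * hab
  have hlog : EqOn (fun s ↦ log (Gamma (s / 3 + 0)) + log (Gamma (s / 3 + 1 / 3)) +
      log (Gamma (s / 3 + 2 / 3)) + log 3 * s + (-log 3 - log (Gamma (1 / 3) * Gamma (2 / 3))))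
      (log ∘ f) (Ioi 0) := by
    intro s hs
    have h0 := hpos (c := 0) hs le_rfl
    have h1 := hpos (c := 1 / 3) hs (by norm_num)
    have h2 := hpos (c := 2 / 3) hs (by norm_num)
    simp only [f, Function.comp_apply]
    rw [log_div (by positivity) (by positivity), log_mul (by positivity) (by positivity),
      log_mul (by positivity) (by positivity), log_mul (by positivity) h2.ne',
      log_mul h0.ne' h1.ne', log_rpow (by norm_num)]
    ring
  have hf : f s = Gamma s := by
    refine eq_Gamma_of_log_convex (ConvexOn.congr ((((hconv le_rfl).add (hconv (by norm_num))).add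
      (hconv (by norm_num))).add ?_ |>.add_const _) hlog) (fun {y} hy ↦ ?_) (fun {y} hy ↦ ?_) ?_ hs
    · exact (convexOn_id (convex_Ioi 0)).smul (log_nonneg (by norm_num))
    · simp only [f]
      rw [show (y + 1) / 3 + 0 = y / 3 + 1 / 3 by ring,
        show (y + 1) / 3 + 1 / 3 = y / 3 + 2 / 3 by ring,
        show (y + 1) / 3 + 2 / 3 = y / 3 + 0 + 1 by ring, Gamma_add_one (by positivity),
        show y + 1 - 1 = y - 1 + 1 by ring, rpow_add_one (by norm_num)]
      ring
    · have h0 := hpos (c := 0) hy le_rfl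
      have h1 := hpos (c := 1 / 3) hy (by norm_num)
      have h2 := hpos (c := 2 / 3) hy (by norm_num)
      simp only [f]
      positivity
    · simp only [f]
      rw [show (1 / 3 + 1 / 3 : ℝ) = 2 / 3 by norm_num, show (1 / 3 + 2 / 3 : ℝ) = 1 by norm_num,
        add_zero, Gamma_one, sub_self, rpow_zero, mul_one, mul_one, div_self (by positivity)]
  rw [← hf, ← neg_sub s 1, rpow_neg (by norm_num)]
  simp only [f, add_zero]
  field_simp

lemma P_one_sixth_eq_Gamma :
    P (1 / 6) (5 / 6) = π * (2 ^ (-5 / 6 : ℝ) * (Gamma (2 / 3) /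
      (Gamma (3 / 4) * Gamma (11 / 12)) * betaR (1 / 12) (2 / 3))) := by
  have hG1 := Gamma_pos_of_pos (s := 2 / 3) (by norm_num)
  have hG2 := Gamma_pos_of_pos (s := 3 / 4) (by norm_num)
  have hG3 := Gamma_pos_of_pos (s := 11 / 12) (by norm_num)
  have hB := betaR_pos (p := 1 / 12) (q := 2 / 3) (by norm_num) (by norm_num)
  have h := congrArg ENNReal.toReal tsum_poch_sq_mul_betaR
  rw [ENNReal.tsum_toReal_eq (fun _ ↦ ENNReal.ofReal_ne_top),
    ENNReal.toReal_ofReal (by positivity)] at h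
  rw [← h, P, F32, mul_assoc, ← tsum_mul_left, show (5 / 6 - 1 / 6 : ℝ) = 2 / 3 by norm_num]
  congr 1
  refine tsum_congr fun k ↦ ?_
  have hBk := betaR_pos (p := 1 / 6 + k) (q := 2 / 3) (by positivity) (by norm_num)
  rw [ENNReal.toReal_ofReal (by positivity), betaR_add_nat (by norm_num) (by norm_num),
    show (1 / 6 + 2 / 3 : ℝ) = 5 / 6 by norm_num, poch_one]
  field_simp
  simp

lemma P_one_sixth_eq_Gamma_one_fourth :
    P (1 / 6) (5 / 6) =
      (2 : ℝ) ^ (-(5 : ℝ) / 6) * (3 : ℝ) ^ (-(1 : ℝ) / 4) * (Gamma (1 / 4) ^ 4 / π) := by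
  have h12 := Gamma_mul_Gamma_add_half (1 / 12)
  have h6 := Gamma_mul_Gamma_add_half (1 / 6)
  have h4 := Gamma_mul_Gamma_one_sub (1 / 4)
  have h3 := Gamma_mul_Gamma_mul_Gamma_third (s := 3 / 4) (by norm_num)
  rw [show (1 / 12 + 1 / 2 : ℝ) = 7 / 12 by norm_num, show (2 * (1 / 12) : ℝ) = 1 / 6 by norm_num,
    show (1 - 1 / 6 : ℝ) = 5 / 6 by norm_num] at h12
  rw [show (1 / 6 + 1 / 2 : ℝ) = 2 / 3 by norm_num, show (2 * (1 / 6) : ℝ) = 1 / 3 by norm_num,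
    show (1 - 1 / 3 : ℝ) = -5 / 6 + 3 / 2 by norm_num, rpow_add two_pos] at h6
  rw [show (1 - 1 / 4 : ℝ) = 3 / 4 by norm_num, show π * (1 / 4) = π / 4 by ring,
    sin_pi_div_four] at h4
  rw [show (3 / 4 / 3 : ℝ) = 1 / 4 by norm_num, show (1 / 4 + 1 / 3 : ℝ) = 7 / 12 by norm_num,
    show (1 / 4 + 2 / 3 : ℝ) = 11 / 12 by norm_num,
    show (1 - 3 / 4 : ℝ) = 1 / 4 by norm_num] at h3
  rw [P_one_sixth_eq_Gamma, betaR, show (1 / 12 + 2 / 3 : ℝ) = 3 / 4 by norm_num,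
    show (-1 / 4 : ℝ) = -(1 / 4) by norm_num, rpow_neg (by norm_num)]
  have e2 : (2 : ℝ) ^ (3 / 2 : ℝ) = 2 * √2 := by
    rw [show (3 / 2 : ℝ) = 1 + 1 / 2 by norm_num, rpow_add two_pos, rpow_one, sqrt_eq_rpow]
  have e1 : (2 : ℝ) ^ (-5 / 6 : ℝ) * 2 ^ (5 / 6 : ℝ) = 1 := by
    rw [← rpow_add two_pos]
    norm_num
  have hx : (0 : ℝ) < 2 ^ (-5 / 6 : ℝ) := by positivity
  have hy : (0 : ℝ) < 3 ^ (1 / 4 : ℝ) := by positivity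
  have hpi := sq_sqrt pi_pos.le
  have h22 := sq_sqrt (zero_le_two (α := ℝ))
  have hp := sqrt_pos.2 pi_pos
  have h2 := sqrt_pos.2 (zero_lt_two (α := ℝ))
  rw [e2] at h6
  generalize (2 : ℝ) ^ (-5 / 6 : ℝ) = x at *
  generalize (2 : ℝ) ^ (5 / 6 : ℝ) = x' at *
  generalize (3 : ℝ) ^ (1 / 4 : ℝ) = y at *
  have g12 := Gamma_pos_of_pos (s := 1 / 12) (by norm_num)
  have g712 := Gamma_pos_of_pos (s := 7 / 12) (by norm_num)
  have g1112 := Gamma_pos_of_pos (s := 11 / 12) (by norm_num)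
  have g6 := Gamma_pos_of_pos (s := 1 / 6) (by norm_num)
  have g4 := Gamma_pos_of_pos (s := 1 / 4) (by norm_num)
  have g34 := Gamma_pos_of_pos (s := 3 / 4) (by norm_num)
  have g3 := Gamma_pos_of_pos (s := 1 / 3) (by norm_num)
  have g23 := Gamma_pos_of_pos (s := 2 / 3) (by norm_num)
  generalize Gamma (1 / 12) = a12 at *
  generalize Gamma (7 / 12) = a712 at *
  generalize Gamma (11 / 12) = a1112 at *
  generalize Gamma (1 / 6) = a6 at *
  generalize Gamma (1 / 4) = a4 at *
  generalize Gamma (3 / 4) = a34 at *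
  generalize Gamma (1 / 3) = a3 at *
  generalize Gamma (2 / 3) = a23 at *
  have ha34 : a34 = π * √2 / a4 := by
    rw [eq_div_iff g4.ne', mul_comm, h4]
    field_simp
    exact h22.symm
  have ha12 : a12 = a6 * x' * √π / a712 := by
    rw [eq_div_iff g712.ne', h12]
  have ha6 : a6 = a3 * (x * (2 * √2)) * √π / a23 := by
    rw [eq_div_iff g23.ne', h6]
  have ha1112 : a1112 = y * (a3 * a23) * a34 / (a4 * a712) := by
    rw [eq_div_iff (by positivity)]
    linear_combination h3
  have ex' : x' = 1 / x := by
    rw [eq_div_iff hx.ne', mul_comm, e1]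
  rw [ha12, ha1112, ha6, ha34, ex']
  field_simp
  rw [hpi, show √2 ^ 2 = 2 from h22, mul_comm]

/-- Evaluation of `P(1/6, 5/6)` in terms of Beta values. -/
theorem P_one_sixth_eval :
    P (1/6) (5/6) = (2 : ℝ) ^ (-(5 : ℝ)/6) * (3 : ℝ) ^ (-(1 : ℝ)/4) * betaR (1/4) (1/4) ^ 2 ∧
    P (1/6) (5/6) = (2 : ℝ) ^ ((1 : ℝ)/6) * (3 : ℝ) ^ (-(1 : ℝ)/4) * betaR (1/4) (1/2) ^ 2 := by
  have h4 := Gamma_mul_Gamma_one_sub (1 / 4)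
  rw [show (1 - 1 / 4 : ℝ) = 3 / 4 by norm_num, show π * (1 / 4) = π / 4 by ring,
    sin_pi_div_four] at h4
  have g4 := Gamma_pos_of_pos (s := 1 / 4) (by norm_num)
  have ha34 : Gamma (3 / 4) = π * √2 / Gamma (1 / 4) := by
    rw [eq_div_iff g4.ne', mul_comm, h4]
    field_simp
    exact (sq_sqrt zero_le_two).symm
  rw [P_one_sixth_eq_Gamma_one_fourth, betaR, betaR,
    show (1 / 4 + 1 / 4 : ℝ) = 1 / 2 by norm_num, show (1 / 4 + 1 / 2 : ℝ) = 3 / 4 by norm_num,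
    ha34, Gamma_one_half_eq, show (1 / 6 : ℝ) = -5 / 6 + 1 by norm_num, rpow_add_one two_ne_zero]
  constructor
  · rw [div_pow, sq_sqrt pi_pos.le]
    ring
  · rw [div_pow, mul_pow, sq_sqrt pi_pos.le, div_pow, mul_pow, sq_sqrt zero_le_two]
    field_simp
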